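/- Let Γ = (S, Act, P) be a finite MDP that is clean with respect to a parity objective φ and with respect to target sets F_1, …, F_n ⊆ S, and let s ∈ S. Then the closure in [0,1]^n of the set {p ∈ [0,1]^n : Γ, s ⊨ S(φ) ∧ ⋀_{i=1}^n Pr_{≥p_i}(◇F_i)} equals the closure of the set {p ∈ [0,1]^n : Γ, s ⊨ ⋀_{i=1}^n Pr_{≥p_i}(◇F_i)}; in particular the two sets have the same topological boundary, i.e., the Pareto frontier does not depend on the sure parity objective. (Lemma 'same-ach'.) -/

import Mathlib

open MeasureTheory ENNReal
open scoped Classical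

/-! ### Markov chains on countable state spaces and their path measures -/

/-- The product σ-algebra on infinite paths over a (discrete) state space `T`. -/
noncomputable def pathsMS (T : Type*) : MeasurableSpace (ℕ → T) :=
  @MeasurableSpace.pi ℕ (fun _ => T) (fun _ => ⊤)

/-- The cylinder set of all paths agreeing with `π` on the first `k+1` states. -/
def Cyl {T : Type*} (π : ℕ → T) (k : ℕ) : Set (ℕ → T) := {ω | ∀ i ≤ k, ω i = π i}

/-- `μ` is the path measure of the Markov chain with transition probabilities `P`
and initial state `s`: it is a probability measure assigning to each cylinder set the
product of the transition probabilities along its prefix. -/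
def IsPathMeasure {T : Type*} (P : T → T → ℝ≥0∞) (s : T)
    (μ : @Measure (ℕ → T) (pathsMS T)) : Prop :=
  μ Set.univ = 1 ∧
  ∀ (π : ℕ → T) (k : ℕ),
    μ (Cyl π k) = if π 0 = s then ∏ i ∈ Finset.range k, P (π i) (π (i + 1)) else 0

/-- The path measure `Pr^M_s` of a Markov chain (it exists and is unique by the
Ionescu–Tulcea/Carathéodory theorems; here it is taken by definite description). -/
noncomputable def pathMeasure {T : Type*} (P : T → T → ℝ≥0∞) (s : T) :
    @Measure (ℕ → T) (pathsMS T) :=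
  if h : ∃ μ, IsPathMeasure P s μ then h.choose else 0

/-- `Paths^M_s`: infinite sequences starting at `s` all of whose steps have positive
transition probability. -/
def PathsFrom {T : Type*} (P : T → T → ℝ≥0∞) (s : T) : Set (ℕ → T) :=
  {ω | ω 0 = s ∧ ∀ i, 0 < P (ω i) (ω (i + 1))}

/-! ### MDPs, strategies, objectives -/

/-- A finite Markov decision process: transition probabilities `P s a s'` such that
for each state-action pair the total mass is `0` or `1` (the action is *enabled* at `s`
in the latter case), and every state has an enabled action. -/
structure MDP (S Act : Type) [Fintype S] [Nonempty S] [Fintype Act] [Nonempty Act] where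
  P : S → Act → S → ℝ≥0∞
  sum_mem : ∀ s a, (∑ s', P s a s') = 0 ∨ (∑ s', P s a s') = 1
  exists_enabled : ∀ s, ∃ a, (∑ s', P s a s') = 1

variable {S Act : Type} [Fintype S] [Nonempty S] [Fintype Act] [Nonempty Act]

/-- A strategy: a machine with countable memory `Q`, initial mode `init`,
deterministic memory update `next`, and output distributions `out` supported on
enabled actions. -/
structure Strategy (M : MDP S Act) where
  Q : Type
  countable : Countable Q
  init : Q
  next : Q → S → Q
  out : Q → S → Act → ℝ≥0∞
  out_sum : ∀ q s, (∑ a, out q s a) = 1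
  out_enabled : ∀ q s a, out q s a ≠ 0 → (∑ s', M.P s a s') = 1

/-- A strategy is finite-memory if its memory set is finite. -/
def Strategy.FiniteMemory {M : MDP S Act} (σ : Strategy M) : Prop := Finite σ.Q

/-- The transition probabilities of the Markov chain `Γ^σ` induced by strategy `σ`
on the state space `S × Q`. -/
noncomputable def MDP.step (M : MDP S Act) (σ : Strategy M) : S × σ.Q → S × σ.Q → ℝ≥0∞ :=
  fun x y => if σ.next x.2 x.1 = y.2 then ∑ a, σ.out x.2 x.1 a * M.P x.1 a y.1 else 0

/-- Lifting an objective over `S` to paths over `S × Q` via the first component. -/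
def liftObj {T Q : Type*} (Ω : Set (ℕ → T)) : Set (ℕ → T × Q) :=
  {ω | (fun i => (ω i).1) ∈ Ω}

/-- `Pr^{Γ^σ}_{(s,q_ι)}(Ω)`: the probability of the (lifted) objective `Ω` in the
Markov chain induced by `σ` started at `(s, σ.init)`. -/
noncomputable def MDP.Pr (M : MDP S Act) (σ : Strategy M) (s : S) (Ω : Set (ℕ → S)) : ℝ≥0∞ :=
  pathMeasure (M.step σ) (s, σ.init) (liftObj Ω)

/-- `Γ, σ, s ⊨ S(Ω)`: every path of the induced Markov chain from `(s, σ.init)`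
(surely) satisfies the lifted objective `Ω`. -/
def MDP.Sure (M : MDP S Act) (σ : Strategy M) (s : S) (Ω : Set (ℕ → S)) : Prop :=
  PathsFrom (M.step σ) (s, σ.init) ⊆ liftObj Ω

/-- The reachability objective `◇F`. -/
def ReachObj {T : Type*} (F : Set T) : Set (ℕ → T) := {π | ∃ k, π k ∈ F}

/-- The set of states occurring infinitely often on a path. -/
def InfOft {T : Type*} (π : ℕ → T) : Set T := {s | ∀ i, ∃ j, i ≤ j ∧ π j = s}

/-- The parity objective for the priority function `φ`: the maximal priority occurring
infinitely often is even. -/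
def ParityObj {T : Type*} (φ : T → ℕ) : Set (ℕ → T) := {π | Even (sSup (φ '' InfOft π))}

/-- A state is a sink if every enabled action loops with probability 1. -/
def MDP.IsSink (M : MDP S Act) (s : S) : Prop :=
  ∀ a, (∑ s', M.P s a s') = 1 → M.P s a s = 1

/-- `Γ` is clean w.r.t. the parity objective `φ`: from every state some strategy
surely satisfies `φ`. -/
def MDP.CleanParity (M : MDP S Act) (φ : S → ℕ) : Prop :=
  ∀ s, ∃ σ : Strategy M, M.Sure σ s (ParityObj φ)

/-- `Γ` is clean w.r.t. the target sets `F 1, …, F n`: every target state is a sink and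
from every state some strategy reaches `F = ⋃ i, F i` with probability 1. -/
def MDP.CleanTargets (M : MDP S Act) {n : ℕ} (F : Fin n → Set S) : Prop :=
  (∀ s ∈ ⋃ i, F i, M.IsSink s) ∧
  ∀ s, ∃ σ : Strategy M, 1 ≤ M.Pr σ s (ReachObj (⋃ i, F i))


/-! ### Existence of path measures -/

theorem measurableSet_Cyl {T : Type*} (π : ℕ → T) (k : ℕ) :
    @MeasurableSet _ (pathsMS T) (Cyl π k) := by
  let : MeasurableSpace T := ⊤
  change @MeasurableSet _ MeasurableSpace.pi (Cyl π k)
  have : Cyl π k = ⋂ i ∈ Set.Iic k, (fun ω : ℕ → T => ω i) ⁻¹' {π i} := by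
    ext ω; simp [Cyl]
  rw [this]
  exact MeasurableSet.biInter (Set.to_countable _)
    fun i _ => measurable_pi_apply i (MeasurableSet.of_discrete)

theorem exists_pathMeasure {T : Type*} [Countable T] (P : T → T → ℝ≥0∞)
    (hP : ∀ x, ∑' y, P x y = 1) (s : T) : ∃ μ, IsPathMeasure P s μ := by
  let : MeasurableSpace T := ⊤
  let p : T → PMF T := fun x => ⟨P x, by rw [← hP x]; exact ENNReal.summable.hasSum⟩
  let κ : (n : ℕ) → ProbabilityTheory.Kernel (Π i : Finset.Iic n, (fun _ : ℕ => T) i) T :=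
    fun n => ⟨fun x => (p (x ⟨n, Finset.mem_Iic.2 le_rfl⟩)).toMeasure,
      measurable_of_countable _⟩
  have : ∀ n, ProbabilityTheory.IsMarkovKernel (κ n) := fun n => ⟨fun x =>
    inferInstanceAs (IsProbabilityMeasure (p (x ⟨n, Finset.mem_Iic.2 le_rfl⟩)).toMeasure)⟩
  let x₀ : Π i : Finset.Iic 0, (fun _ : ℕ => T) i := fun _ => s
  let μ : Measure (ℕ → T) := ProbabilityTheory.Kernel.traj (X := fun _ => T) κ 0 x₀
  have hμ1 : μ Set.univ = 1 := measure_univ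
  suffices hcyl : ∀ (π : ℕ → T) (k : ℕ), μ (Cyl π k) =
      if π 0 = s then ∏ i ∈ Finset.range k, P (π i) (π (i + 1)) else 0 from ⟨μ, hμ1, hcyl⟩
  have hpre : ∀ (π : ℕ → T) (k : ℕ),
      μ (Cyl π k) = (μ.map (Preorder.frestrictLe (π := fun _ => T) k))
        {Preorder.frestrictLe (π := fun _ => T) k π} := by
    intro π k
    rw [Measure.map_apply (Preorder.measurable_frestrictLe _) MeasurableSet.of_discrete]
    congr 1
    ext ω
    simp only [Cyl, Set.mem_ofPred_eq, Set.mem_preimage, Set.mem_singleton_iff, funext_iff]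
    constructor
    · rintro h ⟨i, hi⟩; exact h i (Finset.mem_Iic.1 hi)
    · intro h i hi; exact h ⟨i, Finset.mem_Iic.2 hi⟩
  intro π k
  induction k with
  | zero =>
    rw [hpre]
    have : μ.map (Preorder.frestrictLe (π := fun _ => T) 0) = Measure.dirac x₀ := by
      rw [ProbabilityTheory.Kernel.traj_map_frestrictLe_apply,
        ProbabilityTheory.Kernel.partialTraj_self, ProbabilityTheory.Kernel.id_apply]
    rw [this, Measure.dirac_apply' _ MeasurableSet.of_discrete]
    have h : x₀ = Preorder.frestrictLe (π := fun _ => T) 0 π ↔ π 0 = s := by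
      rw [funext_iff]
      constructor
      · intro h; exact (h ⟨0, by simp⟩).symm
      · rintro h ⟨i, hi⟩
        obtain rfl : i = 0 := by simpa using hi
        exact h.symm
    simp [Set.indicator, h]
  | succ k ih =>
    have h1 : Cyl π (k+1) = (fun x : ℕ → T => (Preorder.frestrictLe (π := fun _ => T) k x, x (k+1))) ⁻¹'
        ({Preorder.frestrictLe (π := fun _ => T) k π} ×ˢ {π (k+1)}) := by
      ext ω
      simp only [Cyl, Set.mem_ofPred_eq, Set.mem_preimage, Set.mem_prod, Set.mem_singleton_iff,
        funext_iff]
      constructor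
      · intro h
        exact ⟨fun i => h i (by have := Finset.mem_Iic.1 i.2; omega), h _ le_rfl⟩
      · rintro ⟨h, h'⟩ i hi
        rcases Nat.lt_or_ge k i with hk | hk
        · obtain rfl : i = k + 1 := by omega
          exact h'
        · exact h ⟨i, Finset.mem_Iic.2 hk⟩
    have h2 := ProbabilityTheory.Kernel.partialTraj_compProd_eq_map_traj (X := fun _ => T)
      (κ := κ) (Nat.zero_le k) (x₀ := x₀)
    rw [h1, ← Measure.map_apply (by fun_prop) (MeasurableSet.of_discrete), ← h2,
      Measure.compProd_apply_prod MeasurableSet.of_discrete MeasurableSet.of_discrete,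
      Measure.restrict_singleton, lintegral_smul_measure, lintegral_dirac,
      ← ProbabilityTheory.Kernel.traj_map_frestrictLe_apply, ← hpre, ih]
    have h3 : κ k (Preorder.frestrictLe (π := fun _ => T) k π) {π (k+1)} = P (π k) (π (k+1)) := by
      change (p (π k)).toMeasure {π (k+1)} = _
      rw [PMF.toMeasure_apply_singleton _ _ MeasurableSet.of_discrete]
      rfl
    rw [h3, Finset.prod_range_succ]
    split_ifs <;> simp

theorem pathMeasure_spec {T : Type*} [Countable T] (P : T → T → ℝ≥0∞)
    (hP : ∀ x, ∑' y, P x y = 1) (s : T) : IsPathMeasure P s (pathMeasure P s) := by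
  have h := exists_pathMeasure P hP s
  rw [pathMeasure, dif_pos h]
  exact h.choose_spec

/-- Almost every path is a path of the chain. -/
theorem null_compl_paths {T : Type*} [Countable T] (P : T → T → ℝ≥0∞) (s : T)
    (μ : @Measure (ℕ → T) (pathsMS T)) (h : IsPathMeasure P s μ) :
    μ (PathsFrom P s)ᶜ = 0 := by
  have hsub : (PathsFrom P s)ᶜ ⊆ ⋃ k : ℕ, ⋃ w : Fin (k+1) → T,
      {ω | (∀ i : Fin (k+1), ω i = w i) ∧ μ (Cyl ω k) = 0} := by
    intro ω hω
    simp only [Set.mem_iUnion]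
    suffices ∃ k, μ (Cyl ω k) = 0 by
      obtain ⟨k, hk⟩ := this
      exact ⟨k, fun i => ω i, fun _ => rfl, hk⟩
    by_cases h0 : ω 0 = s
    · have : ∃ i, P (ω i) (ω (i+1)) = 0 := by
        by_contra hc
        push Not at hc
        exact hω ⟨h0, fun i => pos_iff_ne_zero.2 (hc i)⟩
      obtain ⟨i, hi⟩ := this
      refine ⟨i+1, ?_⟩
      rw [h.2, if_pos h0, Finset.prod_range_succ, hi, mul_zero]
    · exact ⟨0, by rw [h.2, if_neg h0]⟩
  refine measure_mono_null hsub (measure_iUnion_null fun k => measure_iUnion_null fun w => ?_)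
  by_cases hne : ∃ ω₀ : ℕ → T, (∀ i : Fin (k+1), ω₀ i = w i) ∧ μ (Cyl ω₀ k) = 0
  · obtain ⟨ω₀, h1, h2⟩ := hne
    refine measure_mono_null ?_ h2
    rintro ω ⟨h3, -⟩ i hi
    have a := h3 ⟨i, by omega⟩
    have b := h1 ⟨i, by omega⟩
    exact a.trans b.symm
  · convert measure_empty (μ := μ)
    ext ω
    simp only [Set.mem_ofPred_eq, Set.mem_empty_iff_false, iff_false]
    exact fun hω => hne ⟨ω, hω⟩

/-! ### Memory along a path -/

/-- Memory mode of `σ` after reading the first `i` states of `π`. -/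
def memAt {M : MDP S Act} (σ : Strategy M) (π : ℕ → S) : ℕ → σ.Q
  | 0 => σ.init
  | i + 1 => σ.next (memAt σ π i) (π i)

/-- One-step probability of the `i`-th step of `π` under `σ`. -/
noncomputable def stepAt {M : MDP S Act} (σ : Strategy M) (π : ℕ → S) (i : ℕ) : ℝ≥0∞ :=
  ∑ a, σ.out (memAt σ π i) (π i) a * M.P (π i) a (π (i + 1))

theorem step_tsum (M : MDP S Act) (σ : Strategy M) (x : S × σ.Q) :
    ∑' y, M.step σ x y = 1 := by
  have : ∑' y, M.step σ x y = ∑' t : S, ∑' q : σ.Q, M.step σ x (t, q) :=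
    ENNReal.tsum_prod' (f := fun y => M.step σ x y)
  rw [this]
  have h1 : ∀ t : S, ∑' q : σ.Q, M.step σ x (t, q) = ∑ a, σ.out x.2 x.1 a * M.P x.1 a t := by
    intro t
    rw [tsum_eq_single (σ.next x.2 x.1)]
    · simp [MDP.step]
    · intro q hq
      simp [MDP.step, Ne.symm hq]
  simp_rw [h1]
  rw [tsum_fintype, Finset.sum_comm, ← σ.out_sum x.2 x.1]
  refine Finset.sum_congr rfl fun a _ => ?_
  rw [← Finset.mul_sum]
  by_cases h : σ.out x.2 x.1 a = 0
  · simp [h]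
  · rw [σ.out_enabled _ _ _ h, mul_one]

theorem paths_mem {M : MDP S Act} (σ : Strategy M) (s : S) {ω : ℕ → S × σ.Q}
    (h : ω ∈ PathsFrom (M.step σ) (s, σ.init)) (i : ℕ) :
    (ω i).2 = memAt σ (fun j => (ω j).1) i := by
  induction i with
  | zero => rw [h.1]; rfl
  | succ i ih =>
    have h2 := h.2 i
    by_cases hc : σ.next (ω i).2 (ω i).1 = (ω (i+1)).2
    · rw [← hc, ih]; rfl
    · simp [MDP.step, hc] at h2

theorem step_lift {M : MDP S Act} (σ : Strategy M) (π : ℕ → S) (i : ℕ) :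
    M.step σ (π i, memAt σ π i) (π (i+1), memAt σ π (i+1)) = stepAt σ π i := by
  simp [MDP.step, stepAt, memAt]

theorem sure_iff (M : MDP S Act) (σ : Strategy M) (s : S) (Ω : Set (ℕ → S)) :
    M.Sure σ s Ω ↔ ∀ π : ℕ → S, π 0 = s → (∀ i, 0 < stepAt σ π i) → π ∈ Ω := by
  constructor
  · intro h π h0 hp
    have : (fun i => (π i, memAt σ π i)) ∈ liftObj Ω := by
      refine h ⟨by simp [h0, memAt], fun i => ?_⟩
      change 0 < M.step σ (π i, memAt σ π i) (π (i+1), memAt σ π (i+1))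
      rw [step_lift]
      exact hp i
    exact this
  · intro h ω hω
    refine h _ (by rw [hω.1]) fun i => ?_
    rw [← step_lift]
    have := hω.2 i
    rwa [← paths_mem σ s hω, ← paths_mem σ s hω]

theorem measure_prefix {M : MDP S Act} (σ : Strategy M) (s : S) (π : ℕ → S) (N : ℕ) :
    pathMeasure (M.step σ) (s, σ.init) {ω | ∀ i ≤ N, (ω i).1 = π i} =
      if π 0 = s then ∏ i ∈ Finset.range N, stepAt σ π i else 0 := by
  have := σ.countable
  have hμ := pathMeasure_spec (M.step σ) (step_tsum M σ) (s, σ.init)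
  set μ := pathMeasure (M.step σ) (s, σ.init)
  have h1 : μ {ω | ∀ i ≤ N, (ω i).1 = π i} = μ (Cyl (fun i => (π i, memAt σ π i)) N) := by
    apply le_antisymm
    · calc μ {ω | ∀ i ≤ N, (ω i).1 = π i}
          ≤ μ (Cyl (fun i => (π i, memAt σ π i)) N ∪ (PathsFrom (M.step σ) (s, σ.init))ᶜ) := by
            apply measure_mono
            intro ω hω
            by_cases hp : ω ∈ PathsFrom (M.step σ) (s, σ.init)
            · left
              intro i hi
              have hω : ∀ i ≤ N, (ω i).1 = π i := hω
              refine Prod.ext (hω i hi) ?_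
              rw [paths_mem σ s hp]
              have : ∀ j ≤ N, memAt σ (fun j => (ω j).1) j = memAt σ π j := by
                intro j
                induction j with
                | zero => intro _; rfl
                | succ j ih =>
                  intro hj
                  simp only [memAt]
                  rw [ih (by omega), hω j (by omega)]
              exact this i hi
            · exact Or.inr hp
        _ ≤ _ := measure_union_le _ _
        _ = _ := by rw [null_compl_paths _ _ _ hμ, add_zero]
    · apply measure_mono
      intro ω hω i hi
      rw [hω i hi]
  rw [h1, hμ.2]
  simp only [memAt, Prod.mk.injEq, and_true]
  congr 1
  refine Finset.prod_congr rfl fun i _ => step_lift σ π i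

/-- Paths reaching `F` within `N` steps. -/
def reachBy {T Q : Type*} (F : Set T) (N : ℕ) : Set (ℕ → T × Q) :=
  {ω | ∃ k ≤ N, (ω k).1 ∈ F}

theorem measure_reachBy {M : MDP S Act} (σ : Strategy M) (s : S) (F : Set S) (N : ℕ) :
    pathMeasure (M.step σ) (s, σ.init) (reachBy F N) =
      ∑ w ∈ Finset.univ.filter (fun w : Fin (N+1) → S => ∃ k, w k ∈ F),
        (fun π : ℕ → S => if π 0 = s then ∏ i ∈ Finset.range N, stepAt σ π i else 0)
          (fun i => w ⟨min i N, by omega⟩) := by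
  let r : (ℕ → S × σ.Q) → (Fin (N+1) → S) := fun ω i => (ω i).1
  have hr : ∀ w : Fin (N+1) → S, r ⁻¹' {w} =
      {ω | ∀ i ≤ N, (ω i).1 = (fun i => w ⟨min i N, by omega⟩ : ℕ → S) i} := by
    intro w
    ext ω
    simp only [r, Set.mem_preimage, Set.mem_singleton_iff, funext_iff, Set.mem_ofPred_eq]
    constructor
    · intro h i hi
      rw [← h]; simp [hi]
    · intro h i
      rw [h i (by omega)]
      congr 1
      ext
      simp only
      omega
  have hm : ∀ w : Fin (N+1) → S, @MeasurableSet _ (pathsMS _) (r ⁻¹' {w}) := by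
    intro w
    let _ : MeasurableSpace (S × σ.Q) := ⊤
    change @MeasurableSet _ MeasurableSpace.pi (r ⁻¹' {w})
    have : r ⁻¹' {w} = ⋂ i : Fin (N+1), (fun ω : ℕ → S × σ.Q => ω i) ⁻¹' {x | x.1 = w i} := by
      ext ω; simp [r, funext_iff]
    rw [this]
    exact MeasurableSet.iInter
      fun i => measurable_pi_apply (i : ℕ) (MeasurableSet.of_discrete)
  have hE : reachBy F N = r ⁻¹' (↑(Finset.univ.filter
      (fun w : Fin (N+1) → S => ∃ k, w k ∈ F)) : Set (Fin (N+1) → S)) := by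
    ext ω
    simp only [reachBy, Set.mem_ofPred_eq, Set.mem_preimage, Finset.coe_filter,
      Finset.mem_univ, true_and, r]
    constructor
    · rintro ⟨k, hk, h⟩; exact ⟨⟨k, by omega⟩, h⟩
    · rintro ⟨k, h⟩; exact ⟨k, by omega, h⟩
  rw [hE, ← sum_measure_preimage_singleton _ fun w _ => hm w]
  refine Finset.sum_congr rfl fun w _ => ?_
  rw [hr, measure_prefix]

theorem pr_reach {M : MDP S Act} (σ : Strategy M) (s : S) (F : Set S) :
    M.Pr σ s (ReachObj F) = ⨆ N, pathMeasure (M.step σ) (s, σ.init) (reachBy F N) := by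
  rw [← Monotone.measure_iUnion]
  · unfold MDP.Pr
    congr 1
    ext ω
    simp only [liftObj, ReachObj, reachBy, Set.mem_iUnion, Set.mem_ofPred_eq]
    constructor
    · rintro ⟨k, h⟩; exact ⟨k, k, le_rfl, h⟩
    · rintro ⟨_, k, _, h⟩; exact ⟨k, h⟩
  · rintro a b hab ω ⟨k, hk, h⟩
    exact ⟨k, hk.trans hab, h⟩

/-! ### Switching strategies -/

/-- Play `σ` for `N` steps, then switch to `τ t` where `t` is the current state. -/
noncomputable def switchStrat {M : MDP S Act} (σ : Strategy M) (τ : S → Strategy M) (N : ℕ) :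
    Strategy M where
  Q := (ℕ × σ.Q) ⊕ (Σ t : S, (τ t).Q)
  countable := by
    have := σ.countable
    have := fun t => (τ t).countable
    infer_instance
  init := Sum.inl (0, σ.init)
  next
    | Sum.inl (k, q), t =>
      if k < N then Sum.inl (k+1, σ.next q t) else Sum.inr ⟨t, (τ t).next (τ t).init t⟩
    | Sum.inr ⟨u, q⟩, t => Sum.inr ⟨u, (τ u).next q t⟩
  out
    | Sum.inl (k, q), t => if k < N then σ.out q t else (τ t).out (τ t).init t
    | Sum.inr ⟨u, q⟩, t => (τ u).out q t
  out_sum := by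
    rintro (⟨k, q⟩ | ⟨u, q⟩) t
    · by_cases h : k < N
      · simp only [h, if_true]; exact σ.out_sum _ _
      · simp only [h, if_false]; exact (τ t).out_sum _ _
    · exact (τ u).out_sum _ _
  out_enabled := by
    rintro (⟨k, q⟩ | ⟨u, q⟩) t a
    · by_cases h : k < N
      · simp only [h, if_true]; exact σ.out_enabled _ _ _
      · simp only [h, if_false]; exact (τ t).out_enabled _ _ _
    · exact (τ u).out_enabled _ _ _

theorem memAt_switch_le {M : MDP S Act} (σ : Strategy M) (τ : S → Strategy M) (N : ℕ)
    (π : ℕ → S) (i : ℕ) (hi : i ≤ N) :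
    memAt (switchStrat σ τ N) π i = Sum.inl (i, memAt σ π i) := by
  induction i with
  | zero => rfl
  | succ i ih =>
    rw [memAt, ih (by omega)]
    have hiN : i < N := by omega
    exact if_pos hiN

theorem memAt_switch_gt {M : MDP S Act} (σ : Strategy M) (τ : S → Strategy M) (N : ℕ)
    (π : ℕ → S) (i : ℕ) :
    memAt (switchStrat σ τ N) π (N + (i+1)) =
      Sum.inr ⟨π N, memAt (τ (π N)) (fun j => π (N + j)) (i+1)⟩ := by
  induction i with
  | zero =>
    change (switchStrat σ τ N).next (memAt (switchStrat σ τ N) π N) (π N) = _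
    rw [memAt_switch_le _ _ _ _ _ le_rfl]
    exact if_neg (lt_irrefl N)
  | succ i ih =>
    change (switchStrat σ τ N).next (memAt (switchStrat σ τ N) π (N + (i+1))) (π (N+(i+1))) = _
    rw [ih]
    rfl

theorem stepAt_switch_lt {M : MDP S Act} (σ : Strategy M) (τ : S → Strategy M) (N : ℕ)
    (π : ℕ → S) (i : ℕ) (hi : i < N) :
    stepAt (switchStrat σ τ N) π i = stepAt σ π i := by
  unfold stepAt
  rw [memAt_switch_le _ _ _ _ _ hi.le]
  simp [switchStrat, hi]

theorem stepAt_switch_ge {M : MDP S Act} (σ : Strategy M) (τ : S → Strategy M) (N : ℕ)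
    (π : ℕ → S) (i : ℕ) :
    stepAt (switchStrat σ τ N) π (N + i) = stepAt (τ (π N)) (fun j => π (N + j)) i := by
  unfold stepAt
  cases i with
  | zero =>
    rw [add_zero, memAt_switch_le _ _ _ _ _ le_rfl]
    simp [switchStrat, memAt]
  | succ i =>
    rw [memAt_switch_gt]
    simp [switchStrat, add_assoc]

theorem parity_shift {T : Type*} (φ : T → ℕ) (π : ℕ → T) (N : ℕ)
    (h : (fun j => π (N + j)) ∈ ParityObj φ) : π ∈ ParityObj φ := by
  have : InfOft (fun j => π (N + j)) = InfOft π := by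
    ext t
    constructor
    · intro h i
      obtain ⟨j, hj, hj'⟩ := h i
      exact ⟨N + j, by omega, hj'⟩
    · intro h i
      obtain ⟨j, hj, hj'⟩ := h (N + i)
      refine ⟨j - N, by omega, ?_⟩
      have : N + (j - N) = j := by omega
      simpa [this] using hj'
  change Even (sSup (φ '' InfOft π))
  rw [← this]
  exact h

theorem switch_sure {M : MDP S Act} (φ : S → ℕ) (σ : Strategy M) (τ : S → Strategy M) (N : ℕ)
    (hτ : ∀ t, M.Sure (τ t) t (ParityObj φ)) (s : S) :
    M.Sure (switchStrat σ τ N) s (ParityObj φ) := by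
  rw [sure_iff]
  intro π _ hp
  refine parity_shift φ π N ?_
  refine (sure_iff _ _ _ _).1 (hτ (π N)) _ rfl fun i => ?_
  rw [← stepAt_switch_ge σ τ N π i]
  exact hp _

theorem switch_pr {M : MDP S Act} (σ : Strategy M) (τ : S → Strategy M) (N : ℕ) (s : S)
    (F : Set S) :
    pathMeasure (M.step σ) (s, σ.init) (reachBy F N) ≤
      M.Pr (switchStrat σ τ N) s (ReachObj F) := by
  rw [pr_reach]
  refine le_trans (le_of_eq ?_) (le_iSup _ N)
  rw [measure_reachBy, measure_reachBy]
  refine Finset.sum_congr rfl fun w _ => ?_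
  simp only
  congr 1
  refine Finset.prod_congr rfl fun i hi => ?_
  rw [stepAt_switch_lt _ _ _ _ _ (Finset.mem_range.1 hi)]

/-- Every achievable vector can be approximated with sure parity. -/
theorem approx_sure {M : MDP S Act} (φ : S → ℕ) {n : ℕ} (F : Fin n → Set S)
    (hpar : M.CleanParity φ) (s : S) (p : Fin n → ℝ) (σ : Strategy M)
    (hσ : ∀ i, ENNReal.ofReal (p i) ≤ M.Pr σ s (ReachObj (F i))) (ε : ℝ) (hε : 0 < ε) :
    ∃ σ' : Strategy M, M.Sure σ' s (ParityObj φ) ∧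
      ∀ i, ENNReal.ofReal (p i - ε) ≤ M.Pr σ' s (ReachObj (F i)) := by
  choose τ hτ using hpar
  have h1 : ∀ i, ∃ N, ENNReal.ofReal (p i - ε) ≤
      pathMeasure (M.step σ) (s, σ.init) (reachBy (F i) N) := by
    intro i
    rcases le_or_gt (p i - ε) 0 with h | h
    · exact ⟨0, by rw [ENNReal.ofReal_of_nonpos h]; exact zero_le⟩
    · have h2 : ENNReal.ofReal (p i - ε) < M.Pr σ s (ReachObj (F i)) :=
        lt_of_lt_of_le ((ENNReal.ofReal_lt_ofReal_iff (by linarith)).2 (by linarith)) (hσ i)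
      rw [pr_reach, lt_iSup_iff] at h2
      obtain ⟨N, hN⟩ := h2
      exact ⟨N, hN.le⟩
  choose N hN using h1
  let K := Finset.univ.sup N
  refine ⟨switchStrat σ τ K, switch_sure φ σ τ K hτ s, fun i => ?_⟩
  refine (hN i).trans (le_trans (measure_mono ?_) (switch_pr σ τ K s (F i)))
  rintro ω ⟨k, hk, h⟩
  exact ⟨k, hk.trans (Finset.le_sup (Finset.mem_univ i)), h⟩

/-- Lemma `same-ach`: the closure of the set of threshold vectors achievable
together with the sure parity objective equals the closure of the set of achievable threshold
vectors; in particular the two sets have the same topological boundary, i.e., the Pareto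
frontier does not depend on the sure parity objective. -/
theorem pareto_frontier_independent_of_sure_parity
    {S Act : Type} [Fintype S] [Nonempty S] [Fintype Act] [Nonempty Act] {n : ℕ}
    (M : MDP S Act) (φ : S → ℕ) (F : Fin n → Set S)
    (hclean_par : M.CleanParity φ) (hclean_tgt : M.CleanTargets F)
    (s : S) (L A : Set (Fin n → ℝ))
    (hL : L = {p : Fin n → ℝ | (∀ i, p i ∈ Set.Icc (0 : ℝ) 1) ∧
        ∃ σ : Strategy M, M.Sure σ s (ParityObj φ) ∧
          ∀ i, ENNReal.ofReal (p i) ≤ M.Pr σ s (ReachObj (F i))})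
    (hA : A = {p : Fin n → ℝ | (∀ i, p i ∈ Set.Icc (0 : ℝ) 1) ∧
        ∃ σ : Strategy M,
          ∀ i, ENNReal.ofReal (p i) ≤ M.Pr σ s (ReachObj (F i))}) :
    closure L = closure A ∧ frontier L = frontier A := by

  subst hL hA
  set L : Set (Fin n → ℝ) := {p : Fin n → ℝ | (∀ i, p i ∈ Set.Icc (0 : ℝ) 1) ∧
        ∃ σ : Strategy M, M.Sure σ s (ParityObj φ) ∧
          ∀ i, ENNReal.ofReal (p i) ≤ M.Pr σ s (ReachObj (F i))} with hL
  set A : Set (Fin n → ℝ) := {p : Fin n → ℝ | (∀ i, p i ∈ Set.Icc (0 : ℝ) 1) ∧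
        ∃ σ : Strategy M,
          ∀ i, ENNReal.ofReal (p i) ≤ M.Pr σ s (ReachObj (F i))} with hA
  have hsub : L ⊆ A := by
    rintro p ⟨h1, σ, -, h2⟩
    exact ⟨h1, σ, h2⟩
  have hcl : closure L = closure A := by
    refine subset_antisymm (closure_mono hsub) (closure_minimal ?_ isClosed_closure)
    rintro p ⟨hp, σ, hσ⟩
    rw [Metric.mem_closure_iff]
    intro ε hε
    obtain ⟨σ', hs, h'⟩ := approx_sure φ F hclean_par s p σ hσ (ε/2) (by linarith)
    refine ⟨fun i => max (p i - ε/2) 0, ⟨fun i => ⟨le_max_right _ _, ?_⟩, σ', hs, fun i => ?_⟩, ?_⟩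
    · exact max_le (by linarith [(hp i).2]) zero_le_one
    · rcases le_total (p i - ε/2) 0 with h | h
      · simp [max_eq_right h]
      · simp only [max_eq_left h]; exact h' i
    · refine lt_of_le_of_lt ((dist_pi_le_iff (r := ε/2) (by linarith)).2 fun i => ?_)
        (by linarith)
      rw [Real.dist_eq, abs_le]
      have := (hp i).1
      rcases max_cases (p i - ε/2) 0 with h | h <;> constructor <;> linarith [h.1, h.2]
  refine ⟨hcl, ?_⟩
  have hint : interior L = interior A := by
    refine subset_antisymm (interior_mono hsub) (interior_maximal ?_ isOpen_interior)
    intro p hp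
    obtain ⟨ε, hε, hball⟩ := Metric.isOpen_iff.1 isOpen_interior p hp
    have hq : (fun i => p i + ε/2) ∈ A := by
      refine interior_subset (hball ?_)
      rw [Metric.mem_ball]
      refine lt_of_le_of_lt ((dist_pi_le_iff (r := ε/2) (by linarith)).2 fun i => ?_)
        (by linarith)
      rw [Real.dist_eq, add_sub_cancel_left, abs_of_pos (by linarith)]
    obtain ⟨-, σ, hσ⟩ := hq
    obtain ⟨σ', hs, h'⟩ := approx_sure φ F hclean_par s _ σ hσ (ε/2) (by linarith)
    refine ⟨(interior_subset hp).1, σ', hs, fun i => ?_⟩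
    simpa using h' i
  rw [frontier, frontier, hcl, hint]
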